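/- arXiv:2511.10883 — 2 statements merged into one kernel-verified Lean document; each statement's English description precedes it below -/
import Mathlib

section
/- Assume a type B with binary operation ∧ and unary operation ' satisfies (A6) x ∧ (y ∧ z) = y ∧ (z ∧ x) and (J5') x = (x' ∧ y)' ∧ (x' ∧ y')' for all x, y, z. Then the double-negation law x'' = x holds for all x ∈ B. -/
/-- A cyclically associative operation in which every element is a product is commutative. -/
theorem comm_of_cyclic_of_forall_eq_mul {B : Type*} (m : B → B → B)
    (A6 : ∀ x y z, m x (m y z) = m y (m z x))
    (hm : ∀ x, ∃ y z, x = m y z) (x y : B) : m x y = m y x := by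
  obtain ⟨a, b, rfl⟩ := hm x
  obtain ⟨u, v, rfl⟩ := hm y
  obtain ⟨c, d, rfl⟩ := hm u
  obtain ⟨e, f, rfl⟩ := hm v
  calc m (m a b) (m (m c d) (m e f)) = m (m e f) (m (m a b) (m c d)) := by
        rw [← A6 (m e f) (m a b) (m c d)]
    _ = m (m e f) (m c (m d (m a b))) := by rw [A6 (m a b) c d]
    _ = m (m e f) (m c (m a (m b d))) := by rw [A6 d a b]
    _ = m (m e f) (m (m b d) (m c a)) := by rw [← A6 (m b d) c a]
    _ = m (m b d) (m (m c a) (m e f)) := by rw [A6 (m e f) (m b d) (m c a)]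
    _ = m (m b d) (m e (m f (m c a))) := by rw [A6 (m c a) e f]
    _ = m (m b d) (m e (m a (m f c))) := by rw [← A6 a f c]
    _ = m (m b d) (m a (m (m f c) e)) := by rw [A6 e a (m f c)]
    _ = m a (m (m (m f c) e) (m b d)) := by rw [A6 (m b d) a (m (m f c) e)]
    _ = m a (m b (m d (m (m f c) e))) := by rw [A6 (m (m f c) e) b d]
    _ = m (m d (m (m f c) e)) (m a b) := by rw [← A6 (m d (m (m f c) e)) a b]
    _ = m (m e (m d (m f c))) (m a b) := by rw [← A6 e d (m f c)]
    _ = m (m e (m f (m c d))) (m a b) := by rw [A6 d f c]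
    _ = m (m (m c d) (m e f)) (m a b) := by rw [← A6 (m c d) e f]

/-- In a commutative semigroup, Huntington's axiom implies the double-negation law. -/
theorem compl_compl_of_huntington {B : Type*} (m : B → B → B) (c : B → B)
    (comm : ∀ x y, m x y = m y x)
    (assoc : ∀ x y z, m (m x y) z = m x (m y z))
    (huntington : ∀ x y, x = m (c (m (c x) y)) (c (m (c x) (c y)))) (x : B) :
    c (c x) = x := by
  have : Std.Commutative m := ⟨comm⟩
  have : Std.Associative m := ⟨assoc⟩
  have meet_compl (x : B) : m x (c x) = m (c x) (c (c x)) := by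
    calc m x (c x)
        = m (m (c (m (c x) (c (c x)))) (c (m (c x) (c (c (c x))))))
            (m (c (m (c (c x)) (c (c x)))) (c (m (c (c x)) (c (c (c x)))))) :=
          congrArg₂ m (huntington x (c (c x))) (huntington (c x) (c (c x)))
      _ = m (m (c (m (c (c x)) (c x))) (c (m (c (c x)) (c (c x)))))
            (m (c (m (c (c (c x))) (c x))) (c (m (c (c (c x))) (c (c x))))) := by
          ac_rfl
      _ = m (c x) (c (c x)) :=
          (congrArg₂ m (huntington (c x) (c x)) (huntington (c (c x)) (c x))).symm
  calc c (c x)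
      = m (c (m (c (c (c x))) (c x))) (c (m (c (c (c x))) (c (c x)))) :=
        huntington (c (c x)) (c x)
    _ = m (c (m (c x) (c (c x)))) (c (m (c x) (c (c (c x))))) := by
        rw [comm (c (c (c x))) (c x), comm (c (c (c x))) (c (c x)), ← meet_compl (c x)]
        exact comm _ _
    _ = x := (huntington x (c (c x))).symm

/-- Under (A6) and (J5') the double-negation law x'' = x holds. -/
theorem A6_J5'_dneg {B : Type*} (m : B → B → B) (c : B → B)
    (A6 : ∀ x y z, m x (m y z) = m y (m z x))
    (J5' : ∀ x y, x = m (c (m (c x) y)) (c (m (c x) (c y)))) :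
    ∀ x, c (c x) = x := by
  have comm := comm_of_cyclic_of_forall_eq_mul m A6 fun x => ⟨_, _, J5' x x⟩
  have assoc (x y z : B) : m (m x y) z = m x (m y z) := by
    rw [comm (m x y) z, A6 z x y]
  exact compl_compl_of_huntington m c comm assoc J5'
end

section
/- The identities (J1), (A1), (J5') form a 3-base for Boolean algebras: if a nonempty type B equipped with a binary operation ∧ and a unary operation ' satisfies (J1) x ∧ y = y ∧ x, (A1) x ∧ (y ∧ z) = (x ∧ y) ∧ z, and (J5') x = (x' ∧ y)' ∧ (x' ∧ y')' for all x, y, z ∈ B, then there exists a Boolean algebra structure on B whose infimum operation is ∧ and whose complement operation is '. -/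
/-- A commutative semigroup with a unary operation satisfying Huntington's identity. -/
structure IsHuntington {B : Type*} (m : B → B → B) (c : B → B) : Prop where
  comm : ∀ x y, m x y = m y x
  assoc : ∀ x y z, m (m x y) z = m x (m y z)
  huntington : ∀ x y, m (c (m (c x) y)) (c (m (c x) (c y))) = x

namespace IsHuntington

variable {B : Type*} {m : B → B → B} {c : B → B}

theorem left_comm (h : IsHuntington m c) (x y z : B) : m x (m y z) = m y (m x z) := by
  rw [← h.assoc, h.comm x y, h.assoc]

theorem op_op_op_comm (h : IsHuntington m c) (a b x y : B) :
    m (m a b) (m x y) = m (m a x) (m b y) := by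
  rw [h.assoc, h.left_comm b, ← h.assoc]

theorem op_compl_eq_compl_op_compl_compl (h : IsHuntington m c) (x : B) :
    m x (c x) = m (c x) (c (c x)) := by
  have h₁ := h.huntington x (c (c x))
  have h₂ := h.huntington (c x) (c (c x))
  have h₃ := h.huntington (c x) (c x)
  have h₄ := h.huntington (c (c x)) (c x)
  calc
    m x (c x) = m (m (c (m (c x) (c (c x)))) (c (m (c x) (c (c (c x))))))
        (m (c (m (c (c x)) (c (c x)))) (c (m (c (c x)) (c (c (c x)))))) := by rw [h₁, h₂]
    _ = m (m (c (m (c (c x)) (c x))) (c (m (c (c x)) (c (c x)))))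
        (m (c (m (c (c (c x))) (c x))) (c (m (c (c (c x))) (c (c x))))) := by
      rw [h.op_op_op_comm, h.comm (c x) (c (c x)), h.comm (c x) (c (c (c x))),
        h.comm (c (c x)) (c (c (c x)))]
    _ = m (c x) (c (c x)) := by rw [h₃, h₄]

theorem compl_compl (h : IsHuntington m c) (x : B) : c (c x) = x := by
  have h₁ := h.huntington (c (c x)) (c x)
  have h₂ := h.huntington x (c (c x))
  rw [h.comm (c (c (c x))) (c (c x)), ← h.op_compl_eq_compl_op_compl_compl (c x),
    h.comm (c (c (c x))) (c x), h.comm (c (m _ _))] at h₁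
  exact h₁.symm.trans h₂

theorem op_compl_eq (h : IsHuntington m c) (x y : B) : m x (c x) = m y (c y) := by
  have h₁ := h.huntington x y
  have h₂ := h.huntington (c x) y
  have h₃ := h.huntington y x
  have h₄ := h.huntington (c y) x
  rw [h.compl_compl] at h₂ h₄
  calc
    m x (c x) = m (m (c (m (c x) y)) (c (m (c x) (c y)))) (m (c (m x y)) (c (m x (c y)))) := by
      rw [h₁, h₂]
    _ = m (m (c (m (c y) x)) (c (m (c y) (c x)))) (m (c (m y x)) (c (m y (c x)))) := by
      simp only [h.assoc, h.left_comm, h.comm]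
    _ = m y (c y) := by rw [h₃, h₄]

theorem op_compl_op_self (h : IsHuntington m c) (x : B) :
    m (m x (c x)) (m x (c x)) = m x (c x) := by
  generalize hb : m x (c x) = b
  have e (y : B) : m y (c y) = b := (h.op_compl_eq y x).trans hb
  have h₁ : m (c (m b b)) (c b) = c b := by
    have := h.huntington (c b) b
    rwa [h.compl_compl, e] at this
  have h₂ : m b (c (m b b)) = b := by
    calc
      m b (c (m b b)) = m (m b (c b)) (c (m b b)) := by rw [e]
      _ = m b (c b) := by rw [h.assoc, h.comm (c b), h₁]
      _ = b := e b
  calc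
    m b b = m b (m b (c (m b b))) := by rw [h₂]
    _ = b := by rw [← h.assoc, e]

theorem op_compl_op_compl (h : IsHuntington m c) (x y : B) : m x (c (m y (c y))) = x := by
  have h₁ : m (c (m y (c y))) (c (m y (c y))) = c (m y (c y)) := by
    have := h.huntington (c (m y (c y))) (m y (c y))
    rwa [h.compl_compl, ← h.op_compl_eq y (m y (c y)), h.op_compl_op_self] at this
  have h₂ := h.huntington x x
  rw [h.comm (c x) x, h.op_compl_eq x y] at h₂
  rw [← h₂, h.comm (c (m y (c y))) (c (m (c x) (c x))), h.assoc, h₁]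

theorem op_self (h : IsHuntington m c) (x : B) : m x x = x := by
  have := h.huntington (c x) (c x)
  rw [h.compl_compl, h.comm (c (m x (c x))), h.op_compl_op_compl] at this
  rw [← h.compl_compl (m x x), this, h.compl_compl]

theorem op_compl_op (h : IsHuntington m c) (x y : B) : m (m y (c y)) x = m y (c y) := by
  rw [h.op_compl_eq y x, h.comm, ← h.assoc, h.op_self]

theorem op_compl_compl_op_compl (h : IsHuntington m c) (x y : B) :
    m x (c (m (c x) (c y))) = x := by
  nth_rw 1 [← h.huntington x y]
  rw [h.assoc, h.op_self, h.huntington]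

theorem op_eq_left (h : IsHuntington m c) {x y z : B} (hxy : m x (c y) = m z (c z)) :
    m x y = x := by
  have := h.huntington (c x) y
  rw [h.compl_compl, hxy, h.op_compl_op_compl] at this
  rw [← h.compl_compl (m x y), this, h.compl_compl]

theorem op_compl_eq_of_op_eq_left (h : IsHuntington m c) {x y : B} (hxy : m x y = x) :
    m x (c y) = m y (c y) := by
  rw [← hxy, h.assoc, h.comm, h.op_compl_op]

theorem compl_op_compl_op_eq_left (h : IsHuntington m c) {x y z : B}
    (hx : m x z = x) (hy : m y z = y) :
    m (c (m (c x) (c y))) z = c (m (c x) (c y)) := by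
  have key {a b : B} (hab : m a b = a) : m (c b) (c a) = c b := by
    apply h.op_eq_left (z := b)
    rw [h.compl_compl, h.comm, h.op_compl_eq_of_op_eq_left hab]
  have : m (c z) (m (c x) (c y)) = c z := by rw [← h.assoc, key hx, key hy]
  simpa only [h.compl_compl] using key this

theorem sup_op_sup_op_eq_left (h : IsHuntington m c) (x y z : B) :
    m (m (c (m (c x) (c y))) (c (m (c x) (c z)))) (c (m (c x) (c (m y z)))) =
      m (c (m (c x) (c y))) (c (m (c x) (c z))) := by
  apply h.op_eq_left (z := x)
  rw [h.compl_compl]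
  generalize hp : m (m (c (m (c x) (c y))) (c (m (c x) (c z)))) (m (c x) (c (m y z))) = p
  have hy : m p y = p := by
    apply h.op_eq_left (z := m (c x) (c y))
    rw [← h.op_compl_op (m (c (m (c x) (c z))) (c (m y z))) (m (c x) (c y)), ← hp]
    simp only [h.assoc, h.left_comm, h.comm]
  have hz : m p z = p := by
    apply h.op_eq_left (z := m (c x) (c z))
    rw [← h.op_compl_op (m (c (m (c x) (c y))) (c (m y z))) (m (c x) (c z)), ← hp]
    simp only [h.assoc, h.left_comm, h.comm]
  have hyz : m p (m y z) = p := by rw [← h.assoc, hy, hz]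
  have hc : m p (c (m y z)) = p := by
    rw [← hp]
    simp only [h.assoc, h.op_self]
  rw [← hc, h.op_compl_eq_of_op_eq_left hyz, h.op_compl_eq]

/-- The Boolean algebra whose infimum and complement are the given operations. -/
noncomputable abbrev toBooleanAlgebra [Nonempty B] (h : IsHuntington m c) : BooleanAlgebra B where
  le x y := m x y = x
  le_refl := h.op_self
  le_trans x y z hxy hyz := by rw [← hxy, h.assoc, hyz]
  le_antisymm x y hxy hyx := by rw [← hxy, h.comm, hyx]
  inf := m
  inf_le_left x y := by rw [h.comm, ← h.assoc, h.op_self]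
  inf_le_right x y := by rw [h.assoc, h.op_self]
  le_inf x y z hxy hxz := by rw [← h.assoc, hxy, hxz]
  sup x y := c (m (c x) (c y))
  le_sup_left := h.op_compl_compl_op_compl
  le_sup_right x y := by rw [h.comm (c x), h.op_compl_compl_op_compl]
  sup_le _ _ _ := h.compl_op_compl_op_eq_left
  le_sup_inf := h.sup_op_sup_op_eq_left
  compl := c
  top := c (m (Classical.arbitrary B) (c (Classical.arbitrary B)))
  bot := m (Classical.arbitrary B) (c (Classical.arbitrary B))
  le_top x := h.op_compl_op_compl x _
  bot_le x := h.op_compl_op x _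
  inf_compl_le_bot x := h.op_compl_op _ x
  top_le_sup_compl x := h.op_compl_op_compl _ (c x)

end IsHuntington

/-- (J1), (A1), (J5') form a 3-base for Boolean algebras. -/
theorem J1_A1_J5'_base {B : Type*} [Nonempty B] (m : B → B → B) (c : B → B)
    (J1 : ∀ x y, m x y = m y x)
    (A1 : ∀ x y z, m x (m y z) = m (m x y) z)
    (J5' : ∀ x y, x = m (c (m (c x) y)) (c (m (c x) (c y)))) :
    ∃ ba : BooleanAlgebra B, ba.inf = m ∧ ba.compl = c :=
  have h : IsHuntington m c :=
    ⟨J1, fun x y z => (A1 x y z).symm, fun x y => (J5' x y).symm⟩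
  ⟨h.toBooleanAlgebra, rfl, rfl⟩
end
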